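/- There does not exist a strongly regular graph with parameters (28, 9, 0, 4). -/

import Mathlib

open SimpleGraph

open scoped Matrix

/-- The sum of the cubes of the entries of a positive semidefinite matrix is nonnegative. -/
theorem Matrix.PosSemidef.sum_pow_three_nonneg {ι : Type*} [Fintype ι] {N : Matrix ι ι ℝ}
    (hN : N.PosSemidef) : 0 ≤ ∑ i, ∑ j, N i j ^ 3 := by
  classical
  have h := ((hN.hadamard hN).hadamard hN).dotProduct_mulVec_nonneg (fun _ ↦ 1)
  simpa [dotProduct, Matrix.mulVec, pow_succ] using h

/-- In a regular graph, the adjacency matrix commutes with the all-ones matrix. -/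
theorem SimpleGraph.IsRegularOfDegree.adjMatrix_mul_ones {V : Type*} [Fintype V]
    {G : SimpleGraph V} [DecidableRel G.Adj] {d : ℕ} (h : G.IsRegularOfDegree d) :
    G.adjMatrix ℝ * Matrix.of 1 = (d : ℝ) • Matrix.of 1 ∧
      Matrix.of 1 * G.adjMatrix ℝ = (d : ℝ) • Matrix.of 1 := by
  constructor <;> ext i j <;> simp [h.degree_eq]

/-- There does not exist a strongly regular graph with parameters
`(28, 9, 0, 4)`. -/
theorem no_srg_28_9_0_4 :
    ∀ (V : Type*) [Fintype V] (G : SimpleGraph V) [DecidableRel G.Adj],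
      ¬ G.IsSRGWith 28 9 0 4 := by
  intro V _ G _ h
  classical
  set A := G.adjMatrix ℝ with hA
  set J : Matrix V V ℝ := Matrix.of 1 with hJ
  obtain ⟨hAJ, hJA⟩ : A * J = (9 : ℝ) • J ∧ J * A = (9 : ℝ) • J := by
    exact_mod_cast h.regular.adjMatrix_mul_ones
  have hJJ : J * J = (28 : ℝ) • J := by
    ext i j
    simp [hJ, Matrix.mul_apply, h.card]
  have hC : Gᶜ.adjMatrix ℝ = J - 1 - A := by
    have := G.one_add_adjMatrix_add_compl_adjMatrix_eq_of_one (α := ℝ)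
    rw [compl_adjMatrix_eq_adjMatrix_compl] at this
    rw [hJ, ← this, ← hA]
    abel
  have hAA : A * A = (5 : ℝ) • (1 : Matrix V V ℝ) - (4 : ℝ) • A + (4 : ℝ) • J := by
    rw [← sq, hA, h.matrix_eq, hC, ← hA]
    module
  -- A multiple of the projection onto the eigenspace of `A` for the eigenvalue `-5`.
  set N : Matrix V V ℝ := (7 : ℝ) • (1 : Matrix V V ℝ) - (7 : ℝ) • A + (2 : ℝ) • J with hN
  have hNN : N * N = (42 : ℝ) • N := by
    simp only [hN, mul_add, add_mul, mul_sub, sub_mul, Matrix.smul_mul, Matrix.mul_smul, one_mul,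
      mul_one, hAA, hAJ, hJA, hJJ]
    module
  have hNH : Nᴴ = N := by
    ext i j
    simp [hN, hA, hJ, Matrix.one_apply, adjMatrix_apply, G.adj_comm i j, eq_comm]
  have hpos : N.PosSemidef := by
    have := (Matrix.posSemidef_self_mul_conjTranspose N).smul (a := (1 / 42 : ℝ)) (by norm_num)
    rwa [hNH, hNN, smul_smul, show (1 / 42 : ℝ) * 42 = 1 by norm_num, one_smul] at this
  have hcube (i j : V) :
      N i j ^ 3 = 721 * (if i = j then 1 else 0) - 133 * (if G.Adj i j then 1 else 0) + 8 := by
    obtain rfl | hij := eq_or_ne i j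
    · simp [hN, hA, hJ]
      norm_num
    · by_cases hadj : G.Adj i j <;> simp [hN, hA, hJ, hij, hadj] <;> norm_num
  have hsum (i : V) : ∑ j, N i j ^ 3 = -252 := by
    simp only [hcube, Finset.sum_add_distrib, Finset.sum_sub_distrib, ← Finset.mul_sum]
    simp [h.card, h.regular.degree_eq, ← neighborFinset_eq_filter]
    norm_num
  have := hpos.sum_pow_three_nonneg
  norm_num [hsum, h.card] at this
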